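/- arXiv:2503.21252 — 6 statements merged into one kernel-verified Lean document; each statement's English description precedes it below -/
import Mathlib

section
/- For any family of continuous linear functionals (q^k)_{k=1}^K in the dual space V', there exists a unique backward trajectory p = (p^k)_{k=1}^{K+1} in V with p^{K+1} = 0 such that for every k ∈ {1,…,K} and every v ∈ V one has (1/Δt)·m(v, p^k − p^{k+1}) + a(v, p^k) = q^k(v). (Well-posedness of the time-discretized adjoint problem.) -/
/-- Lax–Milgram: a coercive bilinear form represents each functional by a unique vector. -/
theorem IsCoercive.existsUnique_apply_eq
    {V : Type*} [NormedAddCommGroup V] [InnerProductSpace ℝ V] [CompleteSpace V]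
    {B : V →L[ℝ] V →L[ℝ] ℝ} (hB : IsCoercive B) (f : V →L[ℝ] ℝ) :
    ∃! w : V, ∀ v : V, B w v = f v := by
  refine ⟨hB.continuousLinearEquivOfBilin.symm ((InnerProductSpace.toDual ℝ V).symm f),
    fun v => ?_, fun w hw => ?_⟩
  · rw [← hB.continuousLinearEquivOfBilin_apply, ContinuousLinearEquiv.apply_symm_apply,
      InnerProductSpace.toDual_symm_apply]
  · rw [ContinuousLinearEquiv.eq_symm_apply]
    refine (hB.unique_continuousLinearEquivOfBilin fun v => ?_).symm
    rw [InnerProductSpace.toDual_symm_apply, hw]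

/-- Each backward implicit Euler step for the adjoint problem is uniquely solvable. -/
theorem existsUnique_adjoint_implicit_euler_step
    {V : Type*} [NormedAddCommGroup V] [InnerProductSpace ℝ V] [CompleteSpace V]
    (m a : V →L[ℝ] V →L[ℝ] ℝ) (hm_pos : ∀ v : V, 0 ≤ m v v)
    {α : ℝ} (hα : 0 < α) (ha_coer : ∀ v : V, α * ‖v‖ ^ 2 ≤ a v v)
    {Δt : ℝ} (hΔt : 0 < Δt) (f : V →L[ℝ] ℝ) (z : V) :
    ∃! w : V, ∀ v : V, (1 / Δt) * m v (w - z) + a v w = f v := by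
  have hB : IsCoercive ((1 / Δt) • m + a).flip := by
    refine ⟨α, hα, fun u => ?_⟩
    have hmu : 0 ≤ (1 / Δt) * m u u := mul_nonneg (by positivity) (hm_pos u)
    simp only [ContinuousLinearMap.flip_apply, add_apply, smul_apply, smul_eq_mul]
    rw [mul_assoc, ← sq]
    linarith [ha_coer u]
  refine (existsUnique_congr fun w => forall_congr' fun v => ?_).mp
    (hB.existsUnique_apply_eq (f + (1 / Δt) • m.flip z))
  simp only [ContinuousLinearMap.flip_apply, add_apply, smul_apply, smul_eq_mul, map_sub, mul_sub]
  constructor <;> intro h <;> linarith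

/-- Well-posedness of the time-discretized adjoint problem: for any family of continuous
linear functionals `q k` (k = 1,…,K) there is a unique backward trajectory
`p = (p^k)_{k=1}^{K+1}` with `p (K+1) = 0` satisfying the backward time-stepping equations. -/
theorem adjoint_implicit_euler_wellposed
    {V : Type*} [NormedAddCommGroup V] [InnerProductSpace ℝ V] [CompleteSpace V]
    (m a : V →L[ℝ] V →L[ℝ] ℝ)
    (hm_symm : ∀ u v : V, m u v = m v u)
    (hm_pos : ∀ v : V, 0 ≤ m v v)
    (α : ℝ) (hα : 0 < α)
    (ha_coer : ∀ v : V, α * ‖v‖ ^ 2 ≤ a v v)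
    (K : ℕ) (hK : 1 ≤ K)
    (Δt : ℝ) (hΔt : 0 < Δt)
    (q : ℕ → V →L[ℝ] ℝ) :
    ∃ p : ℕ → V,
      (p (K + 1) = 0 ∧
        ∀ k ∈ Finset.Icc 1 K, ∀ v : V,
          (1 / Δt) * m v (p k - p (k + 1)) + a v (p k) = q k v) ∧
      ∀ p' : ℕ → V,
        (p' (K + 1) = 0 ∧
          ∀ k ∈ Finset.Icc 1 K, ∀ v : V,
            (1 / Δt) * m v (p' k - p' (k + 1)) + a v (p' k) = q k v) →
        ∀ k ∈ Finset.Icc 1 (K + 1), p' k = p k := by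
  choose S hS hS_unique using fun (k : ℕ) (z : V) =>
    existsUnique_adjoint_implicit_euler_step m a hm_pos hα ha_coer hΔt (q k) z
  let r : ℕ → V := fun j => Nat.rec 0 (fun i z => S (K - i) z) j
  refine ⟨fun k => r (K + 1 - k), ⟨by simp [r], fun k hk v => ?_⟩, fun p' hp' k hk => ?_⟩
  · obtain ⟨-, hkK⟩ := Finset.mem_Icc.mp hk
    have hr : r (K + 1 - k) = S k (r (K + 1 - (k + 1))) := by
      rw [Nat.add_sub_add_right, Nat.succ_sub hkK]
      change S (K - (K - k)) (r (K - k)) = _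
      rw [Nat.sub_sub_self hkK]
    simp only [hr]
    exact hS k _ v
  · obtain ⟨h_end, h_step⟩ := hp'
    have h_rev : ∀ j ≤ K, p' (K + 1 - j) = r j := by
      intro j
      induction j with
      | zero => exact fun _ => h_end
      | succ j ih =>
        intro hj
        rw [Nat.add_sub_add_right]
        change _ = S (K - j) (r j)
        refine hS_unique (K - j) (r j) _ fun v => ?_
        have h := h_step (K - j) (Finset.mem_Icc.mpr (by omega)) v
        rwa [← Nat.sub_add_comm (by omega : j ≤ K), ih (by omega)] at h
    obtain ⟨hk1, hkK⟩ := Finset.mem_Icc.mp hk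
    have h := h_rev (K + 1 - k) (by omega)
    rwa [Nat.sub_sub_self hkK] at h
end

section
/- Let e = (e^k)_{k=0}^K be a trajectory in V with e^0 = 0, and suppose there are continuous linear functionals ρ^k ∈ V' (k = 1,…,K) such that for every k ∈ {1,…,K} and every v ∈ V one has (1/Δt)·m(e^k − e^{k−1}, v) + a(e^k, v) = ρ^k(v). Then S(e) ≤ α^{-1}·T(ρ). In particular, if u_h with u_h^0 = 0 solves the implicit-Euler scheme (1/Δt)·m(u_h^k − u_h^{k−1}, v) + a(u_h^k, v) = F^k(v) for all v ∈ V, and ũ is any trajectory with ũ^0 = 0, then S(u_h − ũ) ≤ α^{-1}·T(r), where the primal residual is r^k(v) := F^k(v) − a(ũ^k, v) − (1/Δt)·m(ũ^k − ũ^{k−1}, v). (Primal a posteriori error bound, Lemma 3.1, estimate (3.1).) -/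
section ImplicitEuler

variable {V : Type*} [NormedAddCommGroup V] [NormedSpace ℝ V]
  {m a : V →L[ℝ] V →L[ℝ] ℝ} {α τ : ℝ}

/-- Implicit-Euler lower bound for the increment of a symmetric positive-semidefinite form. -/
theorem apply_self_sub_apply_self_le
    (hm_symm : ∀ u v : V, m u v = m v u) (hm_pos : ∀ v : V, 0 ≤ m v v) (x y : V) :
    m x x - m y y ≤ 2 * m (x - y) x := by
  have h := hm_pos (x - y)
  simp only [map_sub, sub_apply] at h ⊢
  linarith [hm_symm x y]

/-- Energy estimate for a single implicit-Euler step. -/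
theorem implicitEuler_step_energy_le
    (hm_symm : ∀ u v : V, m u v = m v u) (hm_pos : ∀ v : V, 0 ≤ m v v)
    (hα : 0 < α) (ha_coer : ∀ v : V, α * ‖v‖ ^ 2 ≤ a v v) (hτ : 0 < τ)
    {x y : V} {ρ : V →L[ℝ] ℝ} (h : 1 / τ * m (x - y) x + a x x = ρ x) :
    α ^ 2 * ‖x‖ ^ 2 + α / τ * (m x x - m y y) ≤ ‖ρ‖ ^ 2 := by
  have hρ : ρ x ≤ ‖ρ‖ * ‖x‖ := (le_abs_self _).trans (ρ.le_opNorm x)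
  have hm : α / τ * (m x x - m y y) ≤ 2 * α * (1 / τ * m (x - y) x) := by
    calc α / τ * (m x x - m y y) ≤ α / τ * (2 * m (x - y) x) := by
          gcongr
          exact apply_self_sub_apply_self_le hm_symm hm_pos x y
      _ = 2 * α * (1 / τ * m (x - y) x) := by ring
  have ha : α * (1 / τ * m (x - y) x) ≤ α * (‖ρ‖ * ‖x‖ - α * ‖x‖ ^ 2) :=
    mul_le_mul_of_nonneg_left (by linarith [ha_coer x]) hα.le
  nlinarith [sq_nonneg (‖ρ‖ - α * ‖x‖)]

/-- Discrete energy estimate for an implicit-Euler trajectory started at zero. -/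
theorem implicitEuler_energy_le
    (hm_symm : ∀ u v : V, m u v = m v u) (hm_pos : ∀ v : V, 0 ≤ m v v)
    (hα : 0 < α) (ha_coer : ∀ v : V, α * ‖v‖ ^ 2 ≤ a v v) (hτ : 0 < τ)
    {e : ℕ → V} {ρ : ℕ → V →L[ℝ] ℝ} (he : e 0 = 0) (n : ℕ)
    (h : ∀ k ∈ Finset.Icc 1 n, ∀ v : V,
      1 / τ * m (e k - e (k - 1)) v + a (e k) v = ρ k v) :
    α ^ 2 * ∑ k ∈ Finset.Icc 1 n, ‖e k‖ ^ 2 + α / τ * m (e n) (e n) ≤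
      ∑ k ∈ Finset.Icc 1 n, ‖ρ k‖ ^ 2 := by
  induction n with
  | zero => simp [he]
  | succ n ih =>
    have ih := ih fun k hk => h k (Finset.Icc_subset_Icc_right n.le_succ hk)
    have hstep := implicitEuler_step_energy_le hm_symm hm_pos hα ha_coer hτ
      (h (n + 1) (by simp) (e (n + 1)))
    rw [Nat.add_sub_cancel] at hstep
    rw [Finset.sum_Icc_succ_top (by omega), Finset.sum_Icc_succ_top (by omega)]
    linarith

/-- Stability of the implicit-Euler scheme in the discrete `L²`-norm in time. -/
theorem implicitEuler_sqrt_sum_le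
    (hm_symm : ∀ u v : V, m u v = m v u) (hm_pos : ∀ v : V, 0 ≤ m v v)
    (hα : 0 < α) (ha_coer : ∀ v : V, α * ‖v‖ ^ 2 ≤ a v v) (hτ : 0 < τ)
    {e : ℕ → V} {ρ : ℕ → V →L[ℝ] ℝ} (he : e 0 = 0) (n : ℕ)
    (h : ∀ k ∈ Finset.Icc 1 n, ∀ v : V,
      1 / τ * m (e k - e (k - 1)) v + a (e k) v = ρ k v) :
    Real.sqrt (τ * ∑ k ∈ Finset.Icc 1 n, ‖e k‖ ^ 2) ≤
      α⁻¹ * Real.sqrt (τ * ∑ k ∈ Finset.Icc 1 n, ‖ρ k‖ ^ 2) := by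
  have hsum : α ^ 2 * ∑ k ∈ Finset.Icc 1 n, ‖e k‖ ^ 2 ≤ ∑ k ∈ Finset.Icc 1 n, ‖ρ k‖ ^ 2 :=
    (le_add_of_nonneg_right (mul_nonneg (div_pos hα hτ).le (hm_pos _))).trans
      (implicitEuler_energy_le hm_symm hm_pos hα ha_coer hτ he n h)
  rw [le_inv_mul_iff₀ hα]
  apply Real.le_sqrt_of_sq_le
  rw [mul_pow, Real.sq_sqrt (by positivity), mul_left_comm]
  gcongr

end ImplicitEuler

/-- Primal a posteriori error bound (Lemma 3.1, estimate (3.1)): any trajectory with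
residual functionals `ρ` satisfies `S(e) ≤ α⁻¹ · T(ρ)`; in particular the error between
the implicit-Euler solution `u_h` and any trajectory `ũ` is bounded via the primal residual. -/
theorem primal_a_posteriori_error_bound
    {V : Type*} [NormedAddCommGroup V] [InnerProductSpace ℝ V] [CompleteSpace V]
    (m a : V →L[ℝ] V →L[ℝ] ℝ)
    (hm_symm : ∀ u v : V, m u v = m v u)
    (hm_pos : ∀ v : V, 0 ≤ m v v)
    (α : ℝ) (hα : 0 < α)
    (ha_coer : ∀ v : V, α * ‖v‖ ^ 2 ≤ a v v)
    (K : ℕ) (hK : 1 ≤ K)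
    (Δt : ℝ) (hΔt : 0 < Δt) :
    (∀ (e : ℕ → V) (ρ : ℕ → V →L[ℝ] ℝ), e 0 = 0 →
      (∀ k ∈ Finset.Icc 1 K, ∀ v : V,
        (1 / Δt) * m (e k - e (k - 1)) v + a (e k) v = ρ k v) →
      Real.sqrt (Δt * ∑ k ∈ Finset.Icc 1 K, ‖e k‖ ^ 2) ≤
        α⁻¹ * Real.sqrt (Δt * ∑ k ∈ Finset.Icc 1 K, ‖ρ k‖ ^ 2)) ∧
    (∀ (F : ℕ → V →L[ℝ] ℝ) (uh ut : ℕ → V) (r : ℕ → V →L[ℝ] ℝ),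
      uh 0 = 0 → ut 0 = 0 →
      (∀ k ∈ Finset.Icc 1 K, ∀ v : V,
        (1 / Δt) * m (uh k - uh (k - 1)) v + a (uh k) v = F k v) →
      (∀ k ∈ Finset.Icc 1 K, ∀ v : V,
        r k v = F k v - a (ut k) v - (1 / Δt) * m (ut k - ut (k - 1)) v) →
      Real.sqrt (Δt * ∑ k ∈ Finset.Icc 1 K, ‖uh k - ut k‖ ^ 2) ≤
        α⁻¹ * Real.sqrt (Δt * ∑ k ∈ Finset.Icc 1 K, ‖r k‖ ^ 2)) := by
  refine ⟨fun e ρ he h => implicitEuler_sqrt_sum_le hm_symm hm_pos hα ha_coer hΔt he K h,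
    fun F uh ut r huh hut hF hr => ?_⟩
  refine implicitEuler_sqrt_sum_le (e := fun k => uh k - ut k) hm_symm hm_pos hα ha_coer hΔt
    (by simp [huh, hut]) K fun k hk v => ?_
  rw [hr k hk v, ← hF k hk v]
  simp only [map_sub, sub_apply]
  ring
end

section
/- Let d : V × V → ℝ be a continuous bilinear form with |d(w,v)| ≤ γ_d·‖w‖·‖v‖ for all w, v ∈ V. Let e_pr = (e_pr^k)_{k=1}^K be a trajectory in V, let Δ_pr ≥ 0 satisfy S(e_pr) ≤ Δ_pr, and let e_ad = (e_ad^k)_{k=1}^{K+1} be a trajectory in V with e_ad^{K+1} = 0 such that for some continuous linear functionals ρ^k ∈ V' (k = 1,…,K) and every v ∈ V, (1/Δt)·m(v, e_ad^k − e_ad^{k+1}) + a(v, e_ad^k) = 2·d(e_pr^k, v) + ρ^k(v). Then S(e_ad) ≤ α^{-1}·(8·γ_d²·Δ_pr² + 2·T(ρ)²)^{1/2}. (Adjoint a posteriori error bound, Lemma 3.1, estimate (3.2).) -/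
/-- Telescoping energy estimate for one backward Euler step of the adjoint problem. -/
theorem adjoint_step_energy_bound
    {V : Type*} [NormedAddCommGroup V] [InnerProductSpace ℝ V]
    (m a : V →L[ℝ] V →L[ℝ] ℝ) (hm_symm : ∀ u v : V, m u v = m v u)
    (hm_pos : ∀ v : V, 0 ≤ m v v) {α : ℝ} (hα : 0 < α)
    (ha_coer : ∀ v : V, α * ‖v‖ ^ 2 ≤ a v v) {τ : ℝ} (hτ : 0 < τ)
    (d : V →L[ℝ] V →L[ℝ] ℝ) {γ : ℝ} (hd : ∀ w v : V, |d w v| ≤ γ * ‖w‖ * ‖v‖)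
    (p x y : V) (ρ : V →L[ℝ] ℝ)
    (h : (1 / τ) * m x (x - y) + a x x = 2 * d p x + ρ x) :
    α / τ * (m x x - m y y) + α ^ 2 * ‖x‖ ^ 2 ≤ 8 * γ ^ 2 * ‖p‖ ^ 2 + 2 * ‖ρ‖ ^ 2 := by
  have hm : (m x x - m y y) / 2 ≤ m x (x - y) := by
    have h0 := hm_pos (x - y)
    simp only [map_sub, sub_apply] at h0 ⊢
    linarith [hm_symm x y]
  have hd' : d p x ≤ γ * ‖p‖ * ‖x‖ := (le_abs_self _).trans (hd p x)
  have hρ : ρ x ≤ ‖ρ‖ * ‖x‖ := (le_abs_self _).trans (ρ.le_opNorm x)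
  have hmτ : 1 / τ * ((m x x - m y y) / 2) ≤ 1 / τ * m x (x - y) :=
    mul_le_mul_of_nonneg_left hm (by positivity)
  have hE : 1 / τ * ((m x x - m y y) / 2) + α * ‖x‖ ^ 2 ≤ (2 * γ * ‖p‖ + ‖ρ‖) * ‖x‖ := by
    linarith [ha_coer x]
  have hE' := mul_le_mul_of_nonneg_left hE (by positivity : 0 ≤ 2 * α)
  have hsplit : 2 * α * (1 / τ * ((m x x - m y y) / 2) + α * ‖x‖ ^ 2) =
      α / τ * (m x x - m y y) + 2 * (α ^ 2 * ‖x‖ ^ 2) := by ring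
  rw [hsplit] at hE'
  linarith [sq_nonneg (α * ‖x‖ - (2 * γ * ‖p‖ + ‖ρ‖)), sq_nonneg (2 * γ * ‖p‖ - ‖ρ‖)]


/-- Adjoint a posteriori error bound (Lemma 3.1, estimate (3.2)). -/
theorem adjoint_a_posteriori_error_bound
    {V : Type*} [NormedAddCommGroup V] [InnerProductSpace ℝ V] [CompleteSpace V]
    (m a : V →L[ℝ] V →L[ℝ] ℝ)
    (hm_symm : ∀ u v : V, m u v = m v u)
    (hm_pos : ∀ v : V, 0 ≤ m v v)
    (α : ℝ) (hα : 0 < α)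
    (ha_coer : ∀ v : V, α * ‖v‖ ^ 2 ≤ a v v)
    (K : ℕ) (hK : 1 ≤ K)
    (Δt : ℝ) (hΔt : 0 < Δt)
    (d : V →L[ℝ] V →L[ℝ] ℝ) (γd : ℝ)
    (hd : ∀ w v : V, |d w v| ≤ γd * ‖w‖ * ‖v‖)
    (epr : ℕ → V) (Δpr : ℝ) (hΔpr : 0 ≤ Δpr)
    (hSpr : Real.sqrt (Δt * ∑ k ∈ Finset.Icc 1 K, ‖epr k‖ ^ 2) ≤ Δpr)
    (ead : ℕ → V) (head : ead (K + 1) = 0)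
    (ρ : ℕ → V →L[ℝ] ℝ)
    (heq : ∀ k ∈ Finset.Icc 1 K, ∀ v : V,
      (1 / Δt) * m v (ead k - ead (k + 1)) + a v (ead k) = 2 * d (epr k) v + ρ k v) :
    Real.sqrt (Δt * ∑ k ∈ Finset.Icc 1 K, ‖ead k‖ ^ 2) ≤
      α⁻¹ * Real.sqrt (8 * γd ^ 2 * Δpr ^ 2 +
        2 * (Δt * ∑ k ∈ Finset.Icc 1 K, ‖ρ k‖ ^ 2)) := by
  have hsum := Finset.sum_le_sum fun k hk =>
    adjoint_step_energy_bound m a hm_symm hm_pos hα ha_coer hΔt d hd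
      (epr k) (ead k) (ead (k + 1)) (ρ k) (heq k hk (ead k))
  simp only [Finset.sum_add_distrib, ← Finset.mul_sum] at hsum
  have htel : ∑ k ∈ Finset.Icc 1 K, (m (ead k) (ead k) - m (ead (k + 1)) (ead (k + 1))) =
      m (ead 1) (ead 1) := by
    have h := Finset.sum_Ico_sub (fun k => m (ead k) (ead k)) (by omega : 1 ≤ K + 1)
    rw [Finset.Ico_add_one_right_eq_Icc] at h
    rw [← neg_inj, ← Finset.sum_neg_distrib]
    simpa [head] using h
  rw [htel] at hsum
  have hM : 0 ≤ α / Δt * m (ead 1) (ead 1) := mul_nonneg (by positivity) (hm_pos _)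
  have hpr : Δt * ∑ k ∈ Finset.Icc 1 K, ‖epr k‖ ^ 2 ≤ Δpr ^ 2 := (Real.sqrt_le_left hΔpr).1 hSpr
  have hbound : α ^ 2 * (Δt * ∑ k ∈ Finset.Icc 1 K, ‖ead k‖ ^ 2) ≤
      8 * γd ^ 2 * Δpr ^ 2 + 2 * (Δt * ∑ k ∈ Finset.Icc 1 K, ‖ρ k‖ ^ 2) := by
    have h₁ := mul_le_mul_of_nonneg_left (by linarith : α ^ 2 * ∑ k ∈ Finset.Icc 1 K, ‖ead k‖ ^ 2 ≤
      8 * γd ^ 2 * ∑ k ∈ Finset.Icc 1 K, ‖epr k‖ ^ 2 + 2 * ∑ k ∈ Finset.Icc 1 K, ‖ρ k‖ ^ 2) hΔt.le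
    have h₂ := mul_le_mul_of_nonneg_left hpr (by positivity : 0 ≤ 8 * γd ^ 2)
    linarith
  rw [le_inv_mul_iff₀ hα]
  calc α * √(Δt * ∑ k ∈ Finset.Icc 1 K, ‖ead k‖ ^ 2)
      = √(α ^ 2 * (Δt * ∑ k ∈ Finset.Icc 1 K, ‖ead k‖ ^ 2)) := by
        rw [Real.sqrt_mul (sq_nonneg α), Real.sqrt_sq hα.le]
    _ ≤ _ := Real.sqrt_le_sqrt hbound
end

section
/- Let W ⊆ V be a closed linear subspace, let d : V × V → ℝ be a continuous symmetric bilinear form with |d(w,v)| ≤ γ_d·‖w‖·‖v‖, let l^k ∈ V' (k = 1,…,K), let F^k ∈ V' (k = 1,…,K), and let c ∈ ℝ. Define the output J(u) := Δt·∑_{k=1}^K [d(u^k, u^k) + l^k(u^k)] + c for trajectories u in V. Suppose: (i) u_h with u_h^0 = 0 satisfies (1/Δt)·m(u_h^k − u_h^{k−1}, v) + a(u_h^k, v) = F^k(v) for all v ∈ V; (ii) u_W is a trajectory in W with u_W^0 = 0 satisfying the same equations for all v ∈ W (primal Galerkin solution in W); (iii) p_W is a trajectory in W with p_W^{K+1}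 = 0 satisfying (1/Δt)·m(v, p_W^k − p_W^{k+1}) + a(v, p_W^k) = 2·d(u_W^k, v) + l^k(v) for all v ∈ W (adjoint Galerkin solution in W). Define the residuals on V: r_pr^k(v) := F^k(v) − a(u_W^k, v) − (1/Δt)·m(u_W^k − u_W^{k−1}, v) and r_ad^k(v) := 2·d(u_W^k, v) + l^k(v) − a(v, p_W^k) − (1/Δt)·m(v, p_W^k − p_W^{k+1}), and set Δ_pr := α^{-1}·T(r_pr). Then |J(u_h) − J(u_W)| ≤ T(r_ad)·Δ_pr + γ_d·Δ_pr². (Theorem 3.1, a posteriori bound for the RB objective functional.) -/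
/-- Cauchy–Schwarz for finite sums carrying a common nonnegative weight. -/
theorem mul_sum_mul_le_sqrt_mul_sqrt {ι : Type*} (s : Finset ι) {t : ℝ} (ht : 0 ≤ t)
    (f g : ι → ℝ) :
    t * ∑ i ∈ s, f i * g i ≤ √(t * ∑ i ∈ s, f i ^ 2) * √(t * ∑ i ∈ s, g i ^ 2) := by
  rw [Real.sqrt_mul ht, Real.sqrt_mul ht]
  calc t * ∑ i ∈ s, f i * g i
      ≤ t * (√(∑ i ∈ s, f i ^ 2) * √(∑ i ∈ s, g i ^ 2)) :=
        mul_le_mul_of_nonneg_left (Real.sum_mul_le_sqrt_mul_sqrt s f g) ht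
    _ = (√t * √t) * (√(∑ i ∈ s, f i ^ 2) * √(∑ i ∈ s, g i ^ 2)) := by
        rw [Real.mul_self_sqrt ht]
    _ = _ := by ring

section Bilinear

variable {V : Type*} [NormedAddCommGroup V] [NormedSpace ℝ V]

/-- Discrete integration by parts for a bilinear form. -/
theorem sum_bilin_forward_diff_eq (m : V →L[ℝ] V →L[ℝ] ℝ) (e p : ℕ → V) (he : e 0 = 0) (n : ℕ) :
    ∑ k ∈ Finset.Icc 1 n, m (e k) (p k - p (k + 1)) =
      ∑ k ∈ Finset.Icc 1 n, m (e k - e (k - 1)) (p k) - m (e n) (p (n + 1)) := by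
  induction n with
  | zero => simp [he]
  | succ n ih =>
    rw [Finset.sum_Icc_succ_top (by omega), Finset.sum_Icc_succ_top (by omega), ih]
    simp only [map_sub, sub_apply, Nat.add_sub_cancel]
    ring

/-- The backward difference is dissipative for a positive semidefinite form. -/
theorem half_bilin_le_sum_backward_diff (m : V →L[ℝ] V →L[ℝ] ℝ)
    (hm_symm : ∀ u v : V, m u v = m v u) (hm_pos : ∀ v : V, 0 ≤ m v v)
    (e : ℕ → V) (he : e 0 = 0) (n : ℕ) :
    m (e n) (e n) / 2 ≤ ∑ k ∈ Finset.Icc 1 n, m (e k - e (k - 1)) (e k) := by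
  induction n with
  | zero => simp [he]
  | succ n ih =>
    rw [Finset.sum_Icc_succ_top (by omega)]
    have h := hm_pos (e (n + 1) - e n)
    have hs := hm_symm (e (n + 1)) (e n)
    simp only [map_sub, sub_apply, Nat.add_sub_cancel] at h ih ⊢
    linarith

/-- The weighted pairing of functionals with vectors is bounded by the product of the
discrete space-time norms. -/
theorem mul_sum_apply_le_sqrt_mul_sqrt {ι : Type*} (s : Finset ι) {t : ℝ} (ht : 0 ≤ t)
    (r : ι → V →L[ℝ] ℝ) (e : ι → V) :
    t * ∑ k ∈ s, |r k (e k)| ≤ √(t * ∑ k ∈ s, ‖r k‖ ^ 2) * √(t * ∑ k ∈ s, ‖e k‖ ^ 2) :=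
  le_trans
    (mul_le_mul_of_nonneg_left (Finset.sum_le_sum fun k _ => (r k).le_opNorm (e k)) ht)
    (mul_sum_mul_le_sqrt_mul_sqrt s ht _ _)

/-- Stability of the implicit Euler scheme for a coercive form, in the discrete
space-time norm. -/
theorem implicitEuler_sqrt_le (m a : V →L[ℝ] V →L[ℝ] ℝ)
    (hm_symm : ∀ u v : V, m u v = m v u) (hm_pos : ∀ v : V, 0 ≤ m v v)
    {α : ℝ} (hα : 0 < α) (ha_coer : ∀ v : V, α * ‖v‖ ^ 2 ≤ a v v)
    (K : ℕ) {t : ℝ} (ht : 0 < t) (e : ℕ → V) (he : e 0 = 0) (r : ℕ → V →L[ℝ] ℝ)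
    (hr : ∀ k ∈ Finset.Icc 1 K, r k (e k) = (1 / t) * m (e k - e (k - 1)) (e k) + a (e k) (e k)) :
    √(t * ∑ k ∈ Finset.Icc 1 K, ‖e k‖ ^ 2) ≤
      α⁻¹ * √(t * ∑ k ∈ Finset.Icc 1 K, ‖r k‖ ^ 2) := by
  set S := √(t * ∑ k ∈ Finset.Icc 1 K, ‖e k‖ ^ 2)
  set T := √(t * ∑ k ∈ Finset.Icc 1 K, ‖r k‖ ^ 2)
  have hT0 : 0 ≤ T := Real.sqrt_nonneg _
  have hS0 : 0 ≤ S := Real.sqrt_nonneg _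
  have hS2 : S ^ 2 = t * ∑ k ∈ Finset.Icc 1 K, ‖e k‖ ^ 2 := Real.sq_sqrt (by positivity)
  have hdiss : 0 ≤ ∑ k ∈ Finset.Icc 1 K, m (e k - e (k - 1)) (e k) :=
    (div_nonneg (hm_pos (e K)) zero_le_two).trans
      (half_bilin_le_sum_backward_diff m hm_symm hm_pos e he K)
  have hcoer : α * ∑ k ∈ Finset.Icc 1 K, ‖e k‖ ^ 2 ≤ ∑ k ∈ Finset.Icc 1 K, a (e k) (e k) := by
    rw [Finset.mul_sum]
    exact Finset.sum_le_sum fun k _ => ha_coer _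
  have hsum : α * ∑ k ∈ Finset.Icc 1 K, ‖e k‖ ^ 2 ≤ ∑ k ∈ Finset.Icc 1 K, |r k (e k)| := by
    calc α * ∑ k ∈ Finset.Icc 1 K, ‖e k‖ ^ 2
        ≤ (1 / t) * ∑ k ∈ Finset.Icc 1 K, m (e k - e (k - 1)) (e k) +
            ∑ k ∈ Finset.Icc 1 K, a (e k) (e k) :=
          hcoer.trans (le_add_of_nonneg_left (mul_nonneg (by positivity) hdiss))
      _ = ∑ k ∈ Finset.Icc 1 K, r k (e k) := by
          rw [Finset.mul_sum, ← Finset.sum_add_distrib]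
          exact Finset.sum_congr rfl fun k hk => (hr k hk).symm
      _ ≤ _ := Finset.sum_le_sum fun k _ => le_abs_self _
  have hquad : α * S ^ 2 ≤ T * S := by
    calc α * S ^ 2 = t * (α * ∑ k ∈ Finset.Icc 1 K, ‖e k‖ ^ 2) := by rw [hS2]; ring
      _ ≤ t * ∑ k ∈ Finset.Icc 1 K, |r k (e k)| := mul_le_mul_of_nonneg_left hsum ht.le
      _ ≤ T * S := mul_sum_apply_le_sqrt_mul_sqrt _ ht.le r e
  rw [le_inv_mul_iff₀ hα]
  rcases hS0.eq_or_lt with h | h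
  · rw [← h, mul_zero]
    exact hT0
  · refine le_of_mul_le_mul_right ?_ h
    linarith [hquad, sq S, mul_assoc α S S]

end Bilinear

/-- Theorem 3.1: a posteriori bound for the RB objective functional,
`|J(u_h) − J(u_W)| ≤ T(r_ad)·Δ_pr + γ_d·Δ_pr²` with `Δ_pr := α⁻¹·T(r_pr)`. -/
theorem objective_a_posteriori_error_bound
    {V : Type*} [NormedAddCommGroup V] [InnerProductSpace ℝ V] [CompleteSpace V]
    (m a : V →L[ℝ] V →L[ℝ] ℝ)
    (hm_symm : ∀ u v : V, m u v = m v u)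
    (hm_pos : ∀ v : V, 0 ≤ m v v)
    (α : ℝ) (hα : 0 < α)
    (ha_coer : ∀ v : V, α * ‖v‖ ^ 2 ≤ a v v)
    (K : ℕ) (hK : 1 ≤ K)
    (Δt : ℝ) (hΔt : 0 < Δt)
    (W : Submodule ℝ V) (hW : IsClosed (W : Set V))
    (d : V →L[ℝ] V →L[ℝ] ℝ) (hd_symm : ∀ w v : V, d w v = d v w)
    (γd : ℝ) (hd : ∀ w v : V, |d w v| ≤ γd * ‖w‖ * ‖v‖)
    (l F : ℕ → V →L[ℝ] ℝ) (c : ℝ)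
    (uh uW pW : ℕ → V)
    (huh0 : uh 0 = 0)
    (huh : ∀ k ∈ Finset.Icc 1 K, ∀ v : V,
      (1 / Δt) * m (uh k - uh (k - 1)) v + a (uh k) v = F k v)
    (huWmem : ∀ k ∈ Finset.Icc 0 K, uW k ∈ W) (huW0 : uW 0 = 0)
    (huW : ∀ k ∈ Finset.Icc 1 K, ∀ v ∈ W,
      (1 / Δt) * m (uW k - uW (k - 1)) v + a (uW k) v = F k v)
    (hpWmem : ∀ k ∈ Finset.Icc 1 (K + 1), pW k ∈ W) (hpWK : pW (K + 1) = 0)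
    (hpW : ∀ k ∈ Finset.Icc 1 K, ∀ v ∈ W,
      (1 / Δt) * m v (pW k - pW (k + 1)) + a v (pW k) = 2 * d (uW k) v + l k v)
    (rpr rad : ℕ → V →L[ℝ] ℝ)
    (hrpr : ∀ k ∈ Finset.Icc 1 K, ∀ v : V,
      rpr k v = F k v - a (uW k) v - (1 / Δt) * m (uW k - uW (k - 1)) v)
    (hrad : ∀ k ∈ Finset.Icc 1 K, ∀ v : V,
      rad k v = 2 * d (uW k) v + l k v - a v (pW k) - (1 / Δt) * m v (pW k - pW (k + 1))) :
    |(Δt * ∑ k ∈ Finset.Icc 1 K, (d (uh k) (uh k) + l k (uh k)) + c) -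
      (Δt * ∑ k ∈ Finset.Icc 1 K, (d (uW k) (uW k) + l k (uW k)) + c)| ≤
      Real.sqrt (Δt * ∑ k ∈ Finset.Icc 1 K, ‖rad k‖ ^ 2) *
        (α⁻¹ * Real.sqrt (Δt * ∑ k ∈ Finset.Icc 1 K, ‖rpr k‖ ^ 2)) +
      γd * (α⁻¹ * Real.sqrt (Δt * ∑ k ∈ Finset.Icc 1 K, ‖rpr k‖ ^ 2)) ^ 2 := by
  set e : ℕ → V := fun k => uh k - uW k with he_def
  have he0 : e 0 = 0 := by simp [he_def, huh0, huW0]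
  have hpr : ∀ k ∈ Finset.Icc 1 K, ∀ v : V,
      rpr k v = (1 / Δt) * m (e k - e (k - 1)) v + a (e k) v := by
    intro k hk v
    rw [hrpr k hk, ← huh k hk v]
    simp only [he_def, map_sub, sub_apply]
    ring
  have hstab := implicitEuler_sqrt_le m a hm_symm hm_pos hα ha_coer K hΔt e he0 rpr
    fun k hk => hpr k hk (e k)
  have horth : ∑ k ∈ Finset.Icc 1 K,
      (a (e k) (pW k) + (1 / Δt) * m (e k) (pW k - pW (k + 1))) = 0 := by
    rw [Finset.sum_add_distrib, ← Finset.mul_sum, sum_bilin_forward_diff_eq m e pW he0 K, hpWK,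
      map_zero, sub_zero, Finset.mul_sum, ← Finset.sum_add_distrib]
    refine Finset.sum_eq_zero fun k hk => ?_
    have hp : pW k ∈ W := hpWmem k (by simp only [Finset.mem_Icc] at hk ⊢; omega)
    rw [add_comm, ← hpr k hk, hrpr k hk, ← huW k hk _ hp]
    ring
  have hrep : (Δt * ∑ k ∈ Finset.Icc 1 K, (d (uh k) (uh k) + l k (uh k)) + c) -
      (Δt * ∑ k ∈ Finset.Icc 1 K, (d (uW k) (uW k) + l k (uW k)) + c) =
      Δt * ∑ k ∈ Finset.Icc 1 K, rad k (e k) + Δt * ∑ k ∈ Finset.Icc 1 K, d (e k) (e k) := by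
    rw [add_sub_add_right_eq_sub, ← mul_sub, ← mul_add, ← Finset.sum_sub_distrib,
      ← Finset.sum_add_distrib]
    congr 1
    rw [← sub_eq_zero, ← Finset.sum_sub_distrib, ← horth]
    refine Finset.sum_congr rfl fun k hk => ?_
    rw [hrad k hk]
    have hs := hd_symm (uh k) (uW k)
    simp only [he_def, map_sub, sub_apply]
    linarith
  set S := √(Δt * ∑ k ∈ Finset.Icc 1 K, ‖e k‖ ^ 2)
  have hS0 : 0 ≤ S := Real.sqrt_nonneg _
  have hS2 : S ^ 2 = Δt * ∑ k ∈ Finset.Icc 1 K, ‖e k‖ ^ 2 := Real.sq_sqrt (by positivity)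
  set D := α⁻¹ * √(Δt * ∑ k ∈ Finset.Icc 1 K, ‖rpr k‖ ^ 2) with hD
  have hlin : |Δt * ∑ k ∈ Finset.Icc 1 K, rad k (e k)| ≤
      √(Δt * ∑ k ∈ Finset.Icc 1 K, ‖rad k‖ ^ 2) * D := by
    rw [abs_mul, abs_of_pos hΔt]
    exact (mul_le_mul_of_nonneg_left (Finset.abs_sum_le_sum_abs _ _) hΔt.le).trans
      ((mul_sum_apply_le_sqrt_mul_sqrt _ hΔt.le rad e).trans
        (mul_le_mul_of_nonneg_left hstab (Real.sqrt_nonneg _)))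
  have hγ : γd * S ^ 2 ≤ γd * D ^ 2 := by
    rcases subsingleton_or_nontrivial V with hV | hV
    · have hr (k : ℕ) : rpr k = 0 := Subsingleton.elim _ _
      have he (k : ℕ) : e k = 0 := Subsingleton.elim _ _
      rw [hS2, hD]
      simp [hr, he]
    · obtain ⟨v, hv⟩ := exists_ne (0 : V)
      have hv' : 0 < ‖v‖ * ‖v‖ := mul_pos (norm_pos_iff.2 hv) (norm_pos_iff.2 hv)
      have hγ0 : 0 ≤ γd := by
        refine nonneg_of_mul_nonneg_left ?_ hv'
        rw [← mul_assoc]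
        exact (abs_nonneg _).trans (hd v v)
      exact mul_le_mul_of_nonneg_left (pow_le_pow_left₀ hS0 hstab 2) hγ0
  have hquad : |Δt * ∑ k ∈ Finset.Icc 1 K, d (e k) (e k)| ≤ γd * S ^ 2 := by
    rw [abs_mul, abs_of_pos hΔt, hS2, mul_left_comm, Finset.mul_sum]
    refine mul_le_mul_of_nonneg_left ((Finset.abs_sum_le_sum_abs _ _).trans
      (Finset.sum_le_sum fun k _ => (hd _ _).trans_eq ?_)) hΔt.le
    ring
  rw [hrep]
  exact (abs_add_le _ _).trans (add_le_add hlin (hquad.trans hγ))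
end

section
/- Let a' : V × V → ℝ be a continuous bilinear form with |a'(w,v)| ≤ γ'·‖w‖·‖v‖, let R^k ∈ V' be a continuous linear functional, let e^k ∈ V, and let δ^{k−1}, δ^k ∈ V satisfy a(δ^k, v) + (1/Δt)·m(δ^k − δ^{k−1}, v) = R^k(v) − a'(e^k, v) for all v ∈ V. Then m(δ^k, δ^k) − m(δ^{k−1}, δ^{k−1}) + Δt·a(δ^k, δ^k) ≤ (Δt/α)·(‖R^k‖_{V'} + γ'·‖e^k‖)². (Per-time-step energy inequality used in the proof of Lemma 4.1.) -/
/-- Per-time-step energy inequality used in the proof of Lemma 4.1. -/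
theorem per_step_energy_inequality
    {V : Type*} [NormedAddCommGroup V] [InnerProductSpace ℝ V] [CompleteSpace V]
    (m a : V →L[ℝ] V →L[ℝ] ℝ)
    (hm_symm : ∀ u v : V, m u v = m v u)
    (hm_pos : ∀ v : V, 0 ≤ m v v)
    (α : ℝ) (hα : 0 < α)
    (ha_coer : ∀ v : V, α * ‖v‖ ^ 2 ≤ a v v)
    (Δt : ℝ) (hΔt : 0 < Δt)
    (a' : V →L[ℝ] V →L[ℝ] ℝ) (γ' : ℝ)
    (ha' : ∀ w v : V, |a' w v| ≤ γ' * ‖w‖ * ‖v‖)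
    (R : V →L[ℝ] ℝ) (e δprev δ : V)
    (heq : ∀ v : V, a δ v + (1 / Δt) * m (δ - δprev) v = R v - a' e v) :
    m δ δ - m δprev δprev + Δt * a δ δ ≤ (Δt / α) * (‖R‖ + γ' * ‖e‖) ^ 2 := by
  set C := ‖R‖ + γ' * ‖e‖ with hC
  have h_load : R δ - a' e δ ≤ C * ‖δ‖ := by
    have hR : R δ ≤ ‖R‖ * ‖δ‖ := (le_abs_self _).trans (R.le_opNorm δ)
    have he := (abs_le.mp (ha' e δ)).1
    rw [hC, add_mul]
    linarith
  have h_young : 2 * (C * ‖δ‖) ≤ C ^ 2 / α + a δ δ := by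
    have hsq : C ^ 2 / α + α * ‖δ‖ ^ 2 - 2 * (C * ‖δ‖) = (C - α * ‖δ‖) ^ 2 / α := by
      field_simp
      ring
    have hnonneg : 0 ≤ (C - α * ‖δ‖) ^ 2 / α := by positivity
    linarith [ha_coer δ]
  have h_polar : m δ δ - m δprev δprev ≤ 2 * m (δ - δprev) δ := by
    have hpos := hm_pos (δ - δprev)
    simp only [map_sub, sub_apply] at hpos ⊢
    linarith [hm_symm δ δprev]
  have h_test : m (δ - δprev) δ = Δt * (R δ - a' e δ - a δ δ) := by
    rw [← heq δ]
    field_simp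
    ring
  calc m δ δ - m δprev δprev + Δt * a δ δ
      ≤ Δt * (2 * (R δ - a' e δ) - a δ δ) := by linarith
    _ ≤ Δt * (C ^ 2 / α) := by gcongr; linarith
    _ = Δt / α * C ^ 2 := by ring
end

section
/- Let d : V × V → ℝ be a bilinear form, l^k ∈ V' and g^k ∈ V' continuous linear functionals (k = 1,…,K), and let u = (u^k)_{k=1}^K be a trajectory in V. Suppose w = (w^k)_{k=0}^K in V with w^0 = 0 satisfies the linearized primal equations (1/Δt)·m(w^k − w^{k−1}, v) + a(w^k, v) = g^k(v) for all k and all v ∈ V, and p = (p^k)_{k=1}^{K+1} in V with p^{K+1} = 0 satisfies the adjoint equations (1/Δt)·m(v, p^k − p^{k+1}) + a(v, p^k) = 2·d(u^k, v) + l^k(v) for all k and all v ∈ V. Then Δt·∑_{k=1}^K [2·d(u^k, w^k) + l^k(w^k)] = Δt·∑_{k=1}^K g^k(p^k). (Discrete adjoint representation identity: the sensitivity-based and adjoint-based expressions for the derivative of the objective functional coincide, justifying formula (2.3).) -/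
/-- Summation by parts for a bilinear form: backward differences in the first argument are
traded for forward differences in the second, up to boundary terms. -/
theorem sum_Icc_bilinear_by_parts {V : Type*} [NormedAddCommGroup V] [NormedSpace ℝ V]
    (m : V →L[ℝ] V →L[ℝ] ℝ) (w p : ℕ → V) (K : ℕ) :
    ∑ k ∈ Finset.Icc 1 K, m (w k) (p k - p (k + 1)) =
      ∑ k ∈ Finset.Icc 1 K, m (w k - w (k - 1)) (p k) + m (w 0) (p 1) - m (w K) (p (K + 1)) := by
  induction K with
  | zero => simp
  | succ K ih =>
    rw [Finset.sum_Icc_succ_top (by omega), Finset.sum_Icc_succ_top (by omega), ih]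
    simp only [map_sub, sub_apply, Nat.add_sub_cancel]
    ring


/-- Discrete adjoint representation identity: the sensitivity-based and adjoint-based
expressions for the derivative of the objective functional coincide (justifying (2.3)). -/
theorem discrete_adjoint_representation
    {V : Type*} [NormedAddCommGroup V] [InnerProductSpace ℝ V] [CompleteSpace V]
    (m a : V →L[ℝ] V →L[ℝ] ℝ)
    (K : ℕ) (hK : 1 ≤ K)
    (Δt : ℝ) (hΔt : 0 < Δt)
    (d : V →ₗ[ℝ] V →ₗ[ℝ] ℝ)
    (l g : ℕ → V →L[ℝ] ℝ)
    (u w p : ℕ → V) (hw0 : w 0 = 0) (hpK : p (K + 1) = 0)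
    (hw : ∀ k ∈ Finset.Icc 1 K, ∀ v : V,
      (1 / Δt) * m (w k - w (k - 1)) v + a (w k) v = g k v)
    (hp : ∀ k ∈ Finset.Icc 1 K, ∀ v : V,
      (1 / Δt) * m v (p k - p (k + 1)) + a v (p k) = 2 * d (u k) v + l k v) :
    Δt * ∑ k ∈ Finset.Icc 1 K, (2 * d (u k) (w k) + l k (w k)) =
      Δt * ∑ k ∈ Finset.Icc 1 K, g k (p k) := by
  have hparts := sum_Icc_bilinear_by_parts m w p K
  simp only [hw0, hpK, map_zero, zero_apply, add_zero, sub_zero] at hparts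
  congr 1
  rw [← Finset.sum_congr rfl fun k hk => hp k hk (w k),
    ← Finset.sum_congr rfl fun k hk => hw k hk (p k),
    Finset.sum_add_distrib, Finset.sum_add_distrib, ← Finset.mul_sum, ← Finset.mul_sum, hparts]
end
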